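/- Let p ≥ 2 and M > 0. Let (F_k)_{k∈ℕ} be a filtration on a probability space (with F_{−1} the trivial σ-algebra) and let (η(k))_{k∈ℕ} be martingale differences: η(k) is F_k-measurable, integrable, E[η(k) | F_{k−1}] = 0, and E[|η(k)|^p | F_{k−1}] ≤ M almost surely for all k. Then there is a constant C depending only on p such that for every finitely supported f : ℕ → ℝ one has E[|∑_k f(k) η(k)|^p] ≤ C (∑_k |f(k)|²)^{p/2} M. -/

import Mathlib

open MeasureTheory Real

lemma mt_young (q s u v : ℝ) (hq : 1 ≤ q) (hs : 0 < s) (hu : 0 < u) (hv : 0 ≤ v) :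
    u ^ q * (v / u) ≤ s⁻¹ * u ^ q + s ^ (q - 1) * v ^ q := by
  have h1 : 0 ≤ u ^ q := by positivity
  have h2 : 0 ≤ s ^ (q - 1) * v ^ q := by positivity
  rcases le_total (v * s) u with h | h
  · have : v / u ≤ s⁻¹ := by
      rw [div_le_iff₀ hu, inv_mul_eq_div, le_div_iff₀ hs]; exact h
    nlinarith [mul_le_mul_of_nonneg_left this h1]
  · have hv' : 0 < v := by
      rcases hv.eq_or_lt with h0 | h0
      · rw [← h0] at h; simp at h; linarith
      · exact h0
    have e1 : u ^ q * (v / u) = u ^ (q - 1) * v := by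
      rw [rpow_sub hu, rpow_one]; ring
    have e2 : v ^ q = v ^ (q - 1) * v := by
      rw [rpow_sub hv', rpow_one]; field_simp
    have e3 : u ^ (q - 1) ≤ v ^ (q - 1) * s ^ (q - 1) := by
      rw [← mul_rpow hv hs.le]
      exact rpow_le_rpow hu.le h (by linarith)
    rw [e1, e2]
    have : 0 ≤ s⁻¹ * u ^ q := by positivity
    nlinarith [mul_le_mul_of_nonneg_right e3 hv]

lemma mt_exp (x : ℝ) : exp x ≤ 1 + x + x ^ 2 * exp |x| := by
  have h := Complex.norm_exp_sub_sum_le_norm_mul_exp (x : ℂ) 2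
  simp only [Finset.sum_range_succ, Finset.sum_range_zero] at h
  have e : Complex.exp x - (0 + (x:ℂ) ^ 0 / (Nat.factorial 0 : ℂ) + (x:ℂ) ^ 1 / (Nat.factorial 1 : ℂ))
      = ((exp x - (1 + x) : ℝ) : ℂ) := by
    push_cast; simp
  rw [e, Complex.norm_real, Complex.norm_real, norm_eq_abs, norm_eq_abs, sq_abs] at h
  linarith [le_abs_self (exp x - (1 + x))]

noncomputable def mtc (p : ℝ) : ℝ := p ^ 2 * exp p + 2 ^ p + p

lemma mt_one (p t : ℝ) (hp : 2 ≤ p) :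
    |1 + t| ^ p ≤ 1 + p * t + mtc p * (t ^ 2 + |t| ^ p) := by
  have h2 : (0:ℝ) < 2 ^ p := by positivity
  have htp : 0 ≤ |t| ^ p := by positivity
  have he := exp_pos p
  unfold mtc
  rcases le_total |t| 1 with h | h
  · have ht := abs_le.1 h
    have h0 : 0 ≤ 1 + t := by linarith
    rw [abs_of_nonneg h0]
    have h1 : (1 + t) ^ p ≤ exp (p * t) := by
      calc (1 + t) ^ p ≤ (exp t) ^ p := by
            apply rpow_le_rpow h0 _ (by linarith)
            linarith [add_one_le_exp t]
        _ = _ := by rw [← exp_mul, mul_comm]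
    have h3 := mt_exp (p * t)
    have h4 : exp |p * t| ≤ exp p := by
      apply exp_le_exp.2
      rw [abs_mul, abs_of_nonneg (by linarith : 0 ≤ p)]
      nlinarith
    have h5 : (p * t) ^ 2 * exp |p * t| ≤ (p * t) ^ 2 * exp p :=
      mul_le_mul_of_nonneg_left h4 (sq_nonneg _)
    have h6 : 0 ≤ (2 ^ p + p) * t ^ 2 := by positivity
    have h7 : 0 ≤ (p ^ 2 * exp p + 2 ^ p + p) * |t| ^ p := by positivity
    nlinarith
  · have h1 : |1 + t| ^ p ≤ 2 ^ p * |t| ^ p := by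
      rw [← mul_rpow (by norm_num) (abs_nonneg t)]
      apply rpow_le_rpow (abs_nonneg _) _ (by linarith)
      have := abs_add_le 1 t
      rw [abs_one] at this
      linarith
    have h3 : |t| ≤ |t| ^ p := by
      conv_lhs => rw [← rpow_one |t|]
      exact rpow_le_rpow_of_exponent_le h (by linarith)
    have h4 := neg_abs_le t
    have h5 : 0 ≤ (p ^ 2 * exp p + 2 ^ p + p) * t ^ 2 := by positivity
    have h6 : 0 ≤ p ^ 2 * exp p * |t| ^ p := by positivity
    nlinarith

lemma mtc_one (p : ℝ) (hp : 2 ≤ p) : 1 ≤ mtc p := by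
  unfold mtc
  have h2 : (0:ℝ) < 2 ^ p := by positivity
  have : 0 ≤ p ^ 2 * exp p := by positivity
  linarith

lemma mt_abs (p x : ℝ) : |x| ^ p = (x ^ 2) ^ (p / 2) := by
  rw [← sq_abs x, ← rpow_natCast, ← rpow_mul (abs_nonneg x)]
  congr 1; push_cast; ring

lemma mt_point (p s x y : ℝ) (hp : 2 ≤ p) (hs : 0 < s) :
    |x + y| ^ p ≤ |x| ^ p + p * (|x| ^ p / x * y)
      + mtc p * (s⁻¹ * |x| ^ p + s ^ (p / 2 - 1) * |y| ^ p + |y| ^ p) := by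
  have hc := mtc_one p hp
  have hyp : 0 ≤ |y| ^ p := by positivity
  have hsp : 0 ≤ s ^ (p / 2 - 1) := by positivity
  by_cases hx : x = 0
  · subst hx
    have : (0:ℝ) ^ p = 0 := zero_rpow (by linarith)
    simp only [abs_zero, this, zero_add, zero_div, zero_mul, mul_zero]
    nlinarith [mul_nonneg hsp hyp, mul_nonneg (by linarith : 0 ≤ mtc p) (mul_nonneg hsp hyp)]
  · have h1 := mt_one p (y / x) hp
    have hx2 : 0 < x ^ 2 := by positivity
    have hY := mt_young (p / 2) s (x ^ 2) (y ^ 2) (by linarith) hs hx2 (sq_nonneg y)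
    rw [← mt_abs, ← mt_abs, ← div_pow] at hY
    have hxp : 0 < |x| ^ p := by positivity
    have e : |x + y| ^ p = |x| ^ p * |1 + y / x| ^ p := by
      rw [← mul_rpow (abs_nonneg _) (abs_nonneg _), ← abs_mul]
      congr 2; field_simp
    have e2 : |x| ^ p * |y / x| ^ p = |y| ^ p := by
      rw [← mul_rpow (abs_nonneg _) (abs_nonneg _), ← abs_mul]
      congr 2; field_simp
    rw [e]
    have := mul_le_mul_of_nonneg_left h1 hxp.le
    calc _ ≤ _ := this
      _ = |x| ^ p + p * (|x| ^ p / x * y) + mtc p * (|x| ^ p * (y / x) ^ 2 + |x| ^ p * |y / x| ^ p) := by ring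
      _ ≤ _ := by
        rw [e2]; gcongr

lemma mt_arith (q c b t A B M : ℝ) (hq : 1 ≤ q) (hc : 1 ≤ c) (hb : 0 < b) (ht : 0 < t) (hM : 0 < M)
    (hA : A ≤ (4 * c) ^ q * b ^ q * M) (hB : B ≤ t ^ q * M) :
    A + c * ((4 * c * b / t)⁻¹ * A + (4 * c * b / t) ^ (q - 1) * B + B)
      ≤ (4 * c) ^ q * (b + t) ^ q * M := by
  set L := 4 * c with hL
  have hL0 : 0 < L := by positivity
  have e1 : ∀ z : ℝ, 0 < z → z ^ q = z ^ (q - 1) * z := fun z hz => by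
    rw [rpow_sub hz, rpow_one]; field_simp
  have hb1 : 0 < b ^ (q - 1) := by positivity
  have ht1 : 0 < t ^ (q - 1) := by positivity
  have hL1 : 1 ≤ L ^ (q - 1) := one_le_rpow (by linarith) (by linarith)
  have k1 : b ^ (q - 1) ≤ (b + t) ^ (q - 1) := rpow_le_rpow hb.le (by linarith) (by linarith)
  have k2 : t ^ (q - 1) ≤ (b + t) ^ (q - 1) := rpow_le_rpow ht.le (by linarith) (by linarith)
  have s1 : (L * b / t)⁻¹ * A ≤ t * L ^ (q - 1) * b ^ (q - 1) * M := by
    calc (L * b / t)⁻¹ * A ≤ (L * b / t)⁻¹ * (L ^ q * b ^ q * M) := by gcongr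
      _ = _ := by rw [e1 L hL0, e1 b hb]; field_simp
  have s2 : (L * b / t) ^ (q - 1) * B ≤ t * L ^ (q - 1) * b ^ (q - 1) * M := by
    calc (L * b / t) ^ (q - 1) * B ≤ (L * b / t) ^ (q - 1) * (t ^ q * M) := by gcongr
      _ = _ := by
        rw [e1 t ht, div_rpow (by positivity) ht.le, mul_rpow hL0.le hb.le]; field_simp
  have s3 : A + c * ((L * b / t)⁻¹ * A + (L * b / t) ^ (q - 1) * B + B) ≤
      L ^ q * b ^ q * M + c * (t * L ^ (q - 1) * b ^ (q - 1) * M + t * L ^ (q - 1) * b ^ (q - 1) * M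
        + L ^ (q - 1) * t ^ q * M) := by
    have : t ^ q * M ≤ L ^ (q - 1) * t ^ q * M := by
      have : 0 ≤ t ^ q * M := by positivity
      nlinarith
    have := hB.trans this
    gcongr
  refine s3.trans ?_
  rw [e1 L hL0, e1 b hb, e1 t ht, e1 (b + t) (by positivity)]
  have : b ^ (q - 1) * b + (t * b ^ (q - 1) + t * b ^ (q - 1) + t ^ (q - 1) * t) / 4 ≤ 
     (b + t) ^ (q - 1) * (b + t) := by nlinarith
  have h := mul_le_mul_of_nonneg_left this (by positivity : 0 ≤ L ^ (q - 1) * L * M)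
  have hc' : c = L / 4 := by rw [hL]; ring
  rw [hc']
  linarith

lemma mt_step {Ω : Type} {m m0 : MeasurableSpace Ω} (hm : m ≤ m0) (μ : Measure Ω)
    [IsProbabilityMeasure μ] (p s : ℝ) (hp : 2 ≤ p) (hs : 0 < s) (X Y : Ω → ℝ)
    (hXm : StronglyMeasurable[m] X) (hX : Integrable (fun ω => |X ω| ^ p) μ)
    (hY : Integrable (fun ω => |Y ω| ^ p) μ) (hYi : Integrable Y μ) (hY0 : μ[Y|m] =ᵐ[μ] 0) :
    ∫ ω, |X ω + Y ω| ^ p ∂μ ≤ ∫ ω, |X ω| ^ p ∂μ +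
      mtc p * (s⁻¹ * ∫ ω, |X ω| ^ p ∂μ + s ^ (p / 2 - 1) * ∫ ω, |Y ω| ^ p ∂μ + ∫ ω, |Y ω| ^ p ∂μ) := by
  have hgm : StronglyMeasurable[m] (fun ω => |X ω| ^ p / X ω) := by
    have h1 : Measurable (fun x : ℝ => |x| ^ p / x) := by fun_prop
    exact (h1.comp hXm.measurable).stronglyMeasurable
  have hgi : Integrable (fun ω => |X ω| ^ p / X ω * Y ω) μ := by
    refine (hX.add hY).mono' ((hgm.mono hm).aestronglyMeasurable.mul hYi.1) (ae_of_all _ fun ω => ?_)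
    simp only [Pi.add_apply, norm_mul, norm_div, norm_eq_abs]
    generalize X ω = x
    generalize Y ω = y
    have h0 : 0 ≤ |x| ^ p := by positivity
    have h0' : 0 ≤ |y| ^ p := by positivity
    rw [abs_of_nonneg h0]
    rcases eq_or_ne x 0 with rfl | hx
    · simp only [abs_zero, div_zero, zero_mul]; positivity
    have hx' : 0 < |x| := abs_pos.2 hx
    rcases le_total |y| |x| with h | h
    · have : |x| ^ p / |x| * |y| ≤ |x| ^ p := by
        rw [div_mul_eq_mul_div, div_le_iff₀ hx']; gcongr
      linarith
    · have e : ∀ z : ℝ, 0 < z → z ^ p = z ^ (p - 1) * z := fun z hz => by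
        rw [rpow_sub hz, rpow_one]; field_simp
      have : |x| ^ p / |x| * |y| ≤ |y| ^ p := by
        rw [e _ hx', e _ (hx'.trans_le h), mul_div_cancel_right₀ _ hx'.ne']
        gcongr
        linarith
      linarith
  have hg0 : ∫ ω, |X ω| ^ p / X ω * Y ω ∂μ = 0 := by
    have h := condExp_mul_of_stronglyMeasurable_left hgm (g := Y) hgi hYi
    rw [← integral_condExp hm]
    rw [show (0:ℝ) = ∫ ω, (0:ℝ) ∂μ by simp]
    apply integral_congr_ae
    filter_upwards [h, hY0] with ω h1 h2
    refine h1.trans ?_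
    simp [h2]
  calc ∫ ω, |X ω + Y ω| ^ p ∂μ ≤ ∫ ω, (|X ω| ^ p + p * (|X ω| ^ p / X ω * Y ω)
      + mtc p * (s⁻¹ * |X ω| ^ p + s ^ (p / 2 - 1) * |Y ω| ^ p + |Y ω| ^ p)) ∂μ := by
        apply integral_mono_of_nonneg (ae_of_all _ fun ω => by positivity)
        · fun_prop
        · exact ae_of_all _ fun ω => mt_point p s _ _ hp hs
    _ = _ := by
      rw [integral_add (by fun_prop) (by fun_prop), integral_add (by fun_prop) (by fun_prop),
        integral_const_mul, integral_const_mul, integral_add (by fun_prop) (by fun_prop),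
        integral_add (by fun_prop) (by fun_prop), integral_const_mul, integral_const_mul, hg0]
      ring

/-- shifted filtration -/
def mtG {Ω : Type} {m0 : MeasurableSpace Ω} (ℱ : Filtration ℕ m0) : ℕ → MeasurableSpace Ω
  | 0 => ⊥
  | k + 1 => ℱ k

theorem mt_main (p : ℝ) (hp : 2 ≤ p) (Ω : Type) (m0 : MeasurableSpace Ω) (μ : Measure Ω)
      [IsProbabilityMeasure μ] (G : ℕ → MeasurableSpace Ω) (hG : ∀ k, G k ≤ m0)
      (η : ℕ → Ω → ℝ) (M : ℝ) (hM : 0 < M)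
      (hi : ∀ k, Integrable (η k) μ)
      (f : ℕ → ℝ)
      (hm : ∀ k, StronglyMeasurable[G k] (fun ω => ∑ j ∈ Finset.range k, f j * η j ω))
      (h0 : ∀ k, μ[η k|G k] =ᵐ[μ] 0)
      (hb : ∀ k, Integrable (fun ω => |η k ω| ^ p) μ → ∫ ω, |η k ω| ^ p ∂μ ≤ M)
      (n : ℕ) (hn : Integrable (fun ω => |∑ j ∈ Finset.range n, f j * η j ω| ^ p) μ)
      (ε : ℝ) (hε : 0 < ε) :
      ∫ ω, |∑ j ∈ Finset.range n, f j * η j ω| ^ p ∂μ ≤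
       (4 * mtc p) ^ (p / 2) * (ε + ∑ j ∈ Finset.range n, f j ^ 2) ^ (p / 2) * M := by
  have hc := mtc_one p hp
  have hint : ∀ k, Integrable (fun ω => ∑ j ∈ Finset.range k, f j * η j ω) μ := fun k =>
    integrable_finsetSum _ fun j _ => (hi j).const_mul _
  have hLp : ∀ Z : Ω → ℝ, Integrable Z μ →
      (Integrable (fun ω => |Z ω| ^ p) μ ↔ MemLp Z (ENNReal.ofReal p) μ) := fun Z hZ => by
    have := integrable_norm_rpow_iff (f := Z) (p := ENNReal.ofReal p) hZ.1
      (by simp; linarith) (by simp)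
    rw [ENNReal.toReal_ofReal (by linarith)] at this
    exact this
  have hcond : ∀ k, μ[fun ω => f k * η k ω|G k] =ᵐ[μ] 0 := fun k => by
    have h1 := condExp_smul (f k) (η k) (G k) (μ := μ)
    filter_upwards [h1, h0 k] with ω h1 h2
    refine h1.trans ?_
    simp [h2]
  induction n with
  | zero =>
    simp only [Finset.range_zero, Finset.sum_empty, abs_zero]
    rw [zero_rpow (by linarith)]
    simp only [integral_zero]
    positivity
  | succ n ih =>
    have hXint := hint n
    have hX1int := hint (n + 1)
    have hXm := hm n
    have hS : (fun ω => ∑ j ∈ Finset.range (n + 1), f j * η j ω) =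
      (fun ω => ∑ j ∈ Finset.range n, f j * η j ω) + fun ω => f n * η n ω := by
      ext ω; simp [Finset.sum_range_succ]
    have hXL : MemLp (fun ω => ∑ j ∈ Finset.range n, f j * η j ω) (ENNReal.ofReal p) μ := by
      have h1 := ((hLp _ hX1int).1 hn).condExp (m := G n)
        (by rw [ENNReal.one_le_ofReal]; linarith)
      refine h1.ae_eq ?_
      rw [hS]
      have h2 := condExp_add hXint ((hi n).const_mul (f n)) (G n)
      rw [condExp_of_stronglyMeasurable (hG n) hXm hXint] at h2
      filter_upwards [h2, hcond n] with ω h2 h3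
      rw [h2, Pi.add_apply, h3]; simp
    have hX := (hLp _ hXint).2 hXL
    have hYL : MemLp (fun ω => f n * η n ω) (ENNReal.ofReal p) μ := by
      have := ((hLp _ hX1int).1 hn).sub hXL
      rw [hS, add_sub_cancel_left] at this
      exact this
    have hYi := (hi n).const_mul (f n)
    have hY := (hLp _ hYi).2 hYL
    have ih := ih hX
    simp only [Finset.sum_range_succ]
    by_cases hf : f n = 0
    · simpa [hf] using ih
    have ht : 0 < f n ^ 2 := by positivity
    have hB : ∫ ω, |f n * η n ω| ^ p ∂μ ≤ (f n ^ 2) ^ (p / 2) * M := by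
      rw [← mt_abs]
      simp only [abs_mul, mul_rpow (abs_nonneg _) (abs_nonneg _)] at hY ⊢
      rw [integral_const_mul]
      have hfp : 0 < |f n| ^ p := by positivity
      have : Integrable (fun ω => |η n ω| ^ p) μ := by
        have := hY.const_mul (|f n| ^ p)⁻¹
        refine this.congr (ae_of_all _ fun ω => ?_)
        simp only; field_simp
      exact mul_le_mul_of_nonneg_left (hb n this) hfp.le
    have hbpos : 0 < ε + ∑ j ∈ Finset.range n, f j ^ 2 :=
      add_pos_of_pos_of_nonneg hε (Finset.sum_nonneg fun _ _ => sq_nonneg _)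
    have hst := mt_step (hG n) μ p (4 * mtc p * (ε + ∑ j ∈ Finset.range n, f j ^ 2) / f n ^ 2) hp
      (by positivity) _ _ hXm hX hY hYi (hcond n)
    refine hst.trans ?_
    rw [← add_assoc]
    exact mt_arith (p / 2) (mtc p) _ _ _ _ M (by linarith) hc hbpos ht hM ih hB

theorem martingale_transform_moment_bound (p : ℝ) (hp : 2 ≤ p) :
    ∃ C : ℝ, ∀ (Ω : Type) (m0 : MeasurableSpace Ω) (μ : Measure Ω),
      IsProbabilityMeasure μ →
      ∀ (ℱ : Filtration ℕ m0) (η : ℕ → Ω → ℝ) (M : ℝ), 0 < M →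
      (∀ k, Integrable (η k) μ) →
      (∀ k, StronglyMeasurable[ℱ k] (η k)) →
      (∫ ω, η 0 ω ∂μ = 0) →
      (∀ k, μ[η (k + 1)|ℱ k] =ᵐ[μ] 0) →
      (∫ ω, |η 0 ω| ^ p ∂μ ≤ M) →
      (∀ k, ∀ᵐ ω ∂μ, (μ[fun ω' => |η (k + 1) ω'| ^ p|ℱ k]) ω ≤ M) →
      ∀ f : ℕ → ℝ, (Function.support f).Finite →
      ∫ ω, |∑' k : ℕ, f k * η k ω| ^ p ∂μ ≤ C * (∑' k : ℕ, (f k) ^ 2) ^ (p / 2) * M := by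
  have hc := mtc_one p hp
  refine ⟨(4 * mtc p) ^ (p / 2), ?_⟩
  intro Ω m0 μ hμ ℱ η M hM hi hm h00 h0 hb0 hb f hf
  obtain ⟨n, hn⟩ : ∃ n, ∀ k, k ∉ Finset.range n → f k = 0 := by
    obtain ⟨B, hB⟩ := hf.bddAbove
    refine ⟨B + 1, fun k hk => ?_⟩
    by_contra h
    have := hB (show k ∈ Function.support f from h)
    simp at hk; omega
  have e1 : ∀ ω, ∑' k : ℕ, f k * η k ω = ∑ k ∈ Finset.range n, f k * η k ω := fun ω =>
    tsum_eq_sum fun k hk => by simp [hn k hk]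
  have e2 : ∑' k : ℕ, (f k) ^ 2 = ∑ k ∈ Finset.range n, (f k) ^ 2 :=
    tsum_eq_sum fun k hk => by simp [hn k hk]
  simp only [e1, e2]
  have hs0 : 0 ≤ ∑ k ∈ Finset.range n, (f k) ^ 2 := Finset.sum_nonneg fun _ _ => sq_nonneg _
  by_cases hI : Integrable (fun ω => |∑ j ∈ Finset.range n, f j * η j ω| ^ p) μ
  swap
  · rw [integral_undef hI]; positivity
  have key := mt_main p hp Ω m0 μ (mtG ℱ)
    (by intro k; cases k with
        | zero => exact bot_le
        | succ k => exact ℱ.le k) η M hM hi f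
    (by intro k; cases k with
        | zero => simp only [Finset.range_zero, Finset.sum_empty]; exact stronglyMeasurable_const
        | succ k =>
          refine Finset.stronglyMeasurable_fun_sum _ fun j hj => ?_
          refine StronglyMeasurable.const_mul ?_ _
          exact (hm j).mono (ℱ.mono (by simp at hj; omega)))
    (by intro k; cases k with
        | zero => simp only [mtG]; rw [condExp_bot, h00]; rfl
        | succ k => exact h0 k)
    (by intro k hk; cases k with
        | zero => exact hb0
        | succ k =>
          rw [← integral_condExp (ℱ.le k)]
          calc _ ≤ ∫ ω, M ∂μ := integral_mono_ae integrable_condExp (integrable_const _) (hb k)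
            _ = M := by simp) n hI
  have hcont : ContinuousAt (fun ε : ℝ => (4 * mtc p) ^ (p / 2) *
      (ε + ∑ j ∈ Finset.range n, f j ^ 2) ^ (p / 2) * M) 0 := by
    have : ContinuousAt (fun ε : ℝ => (ε + ∑ j ∈ Finset.range n, f j ^ 2) ^ (p / 2)) 0 :=
      ContinuousAt.rpow_const (by fun_prop) (Or.inr (by linarith))
    fun_prop
  have ht := hcont.tendsto.mono_left (nhdsWithin_le_nhds (s := Set.Ioi 0))
  simp only [zero_add] at ht
  exact ge_of_tendsto ht (by filter_upwards [self_mem_nhdsWithin] with ε hε using key ε hε)
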